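/- Let q > 1 be real and let D₃ = diag(q, q, −q⁻¹), U₃ = ((1,0,0),(0, 1/[2]_q, √[3]_q/[2]_q),(0, −√[3]_q/[2]_q, 1/[2]_q)), V₃ = ((1/[3]_q, [2]_q√(q²+q⁻²)/[3]_q, 0),(−[2]_q√(q²+q⁻²)/[3]_q, 1/[3]_q, 0),(0,0,1)). Set R₁ = D₃, R₂ = U₃·D₃·U₃ᵀ and R₃ = (U₃·V₃·U₃)·D₃·(U₃·V₃·U₃)ᵀ. Then the characteristic polynomial of R₁·R₂·R₃ is (X + q)(X² + q²) = X³ + qX² + q²X + q³, i.e. its eigenvalues are q·e^{2πik/4} for k = 1, 2, 3. -/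

import Mathlib

open Matrix Polynomial

/-- The quantum integer `[n]_q = (qⁿ − q⁻ⁿ)/(q − q⁻¹)`. -/
noncomputable def qn (q : ℝ) (n : ℤ) : ℝ := (q ^ n - q ^ (-n)) / (q - q⁻¹)

/-- The diagonal R-matrix on the `[31]` multiplicity space: `D₃ = diag(q, q, −q⁻¹)`. -/
noncomputable def D3 (q : ℝ) : Matrix (Fin 3) (Fin 3) ℝ :=
  !![q, 0, 0; 0, q, 0; 0, 0, -q⁻¹]

/-- The mixing matrix `U₃` (rotating the last two basis vectors, cosine `1/[2]_q`). -/
noncomputable def U3 (q : ℝ) : Matrix (Fin 3) (Fin 3) ℝ :=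
  !![1, 0, 0;
     0, 1 / qn q 2, Real.sqrt (qn q 3) / qn q 2;
     0, -Real.sqrt (qn q 3) / qn q 2, 1 / qn q 2]

/-- The mixing matrix `V₃` (rotating the first two basis vectors, cosine `1/[3]_q`). -/
noncomputable def V3 (q : ℝ) : Matrix (Fin 3) (Fin 3) ℝ :=
  !![1 / qn q 3, qn q 2 * Real.sqrt (q ^ (2 : ℤ) + q ^ (-2 : ℤ)) / qn q 3, 0;
     -(qn q 2 * Real.sqrt (q ^ (2 : ℤ) + q ^ (-2 : ℤ)) / qn q 3), 1 / qn q 3, 0;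
     0, 0, 1]

lemma R2_aux (q b t p : ℝ) (hb : b ≠ 0) (hp : p = q - b) (ht : t ^ 2 = b ^ 2 - 1) :
    (!![1, 0, 0; 0, 1 / b, t / b; 0, -t / b, 1 / b] : Matrix (Fin 3) (Fin 3) ℝ)
      * !![q, 0, 0; 0, q, 0; 0, 0, p] * (!![1, 0, 0; 0, 1 / b, t / b; 0, -t / b, 1 / b])ᵀ
    = !![q, 0, 0; 0, q - t ^ 2 / b, -t / b; 0, -t / b, q - 1 / b] := by
  subst hp
  ext i j
  fin_cases i <;> fin_cases j <;>
    simp [Matrix.mul_apply, Fin.sum_univ_three] <;> field_simp <;> grind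

lemma M_aux (b t w : ℝ) (hb : b ≠ 0) (h0 : t ≠ 0) (ht : t ^ 2 = b ^ 2 - 1) :
    (!![1, 0, 0; 0, 1 / b, t / b; 0, -t / b, 1 / b] : Matrix (Fin 3) (Fin 3) ℝ)
      * !![1 / t ^ 2, b * w / t ^ 2, 0; -(b * w / t ^ 2), 1 / t ^ 2, 0; 0, 0, 1]
      * !![1, 0, 0; 0, 1 / b, t / b; 0, -t / b, 1 / b]
    = !![1 / t ^ 2, w / t ^ 2, w / t; -(w / t ^ 2), 1 / t ^ 2 - 1, 1 / t; w / t, -(1 / t), 0] := by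
  ext i j
  fin_cases i <;> fin_cases j <;>
    simp [Matrix.mul_apply, Fin.sum_univ_three] <;> field_simp <;> grind

lemma R3_aux (q b t w p : ℝ) (h0 : t ≠ 0) (hp : p = q - b) (hw : w ^ 2 = t ^ 2 - 1) :
    (!![1 / t ^ 2, w / t ^ 2, w / t; -(w / t ^ 2), 1 / t ^ 2 - 1, 1 / t; w / t, -(1 / t), 0]
      : Matrix (Fin 3) (Fin 3) ℝ) * !![q, 0, 0; 0, q, 0; 0, 0, p] *
    (!![1 / t ^ 2, w / t ^ 2, w / t; -(w / t ^ 2), 1 / t ^ 2 - 1, 1 / t; w / t, -(1 / t), 0])ᵀ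
    = !![q - b * w ^ 2 / t ^ 2, -(b * w / t ^ 2), 0;
         -(b * w / t ^ 2), q - b / t ^ 2, 0; 0, 0, q] := by
  subst hp
  ext i j
  fin_cases i <;> fin_cases j <;>
    simp [Matrix.mul_apply, Fin.sum_univ_three] <;> field_simp <;> grind

lemma charpoly_three (A : Matrix (Fin 3) (Fin 3) ℝ) (e1 e2 e3 : ℝ)
    (h1 : A 0 0 + A 1 1 + A 2 2 = -e1)
    (h2 : A 0 0 * A 1 1 - A 0 1 * A 1 0 + A 0 0 * A 2 2 - A 0 2 * A 2 0
      + A 1 1 * A 2 2 - A 1 2 * A 2 1 = e2)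
    (h3 : A.det = -e3) :
    A.charpoly = X ^ 3 + C e1 * X ^ 2 + C e2 * X + C e3 := by
  have h1' : e1 = -(A 0 0 + A 1 1 + A 2 2) := by linarith
  have h3' : e3 = -A.det := by linarith
  subst h2 h1' h3'
  rw [Matrix.charpoly, Matrix.det_fin_three, Matrix.det_fin_three]
  simp [Matrix.charmatrix_apply]
  ring

/-- with `R₁ = D₃`, `R₂ = U₃·D₃·U₃ᵀ`, `R₃ = (U₃V₃U₃)·D₃·(U₃V₃U₃)ᵀ`, the
characteristic polynomial of `R₁R₂R₃` is `X³ + qX² + q²X + q³ = (X+q)(X²+q²)`,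
i.e. the eigenvalues are `q·e^{2πik/4}`, `k = 1, 2, 3`. -/
theorem torus_period_31_sector_charpoly (q : ℝ) (hq : 1 < q) :
    (D3 q * (U3 q * D3 q * (U3 q)ᵀ) *
        ((U3 q * V3 q * U3 q) * D3 q * (U3 q * V3 q * U3 q)ᵀ)).charpoly =
      X ^ 3 + C q * X ^ 2 + C (q ^ 2) * X + C (q ^ 3) := by
  have q0 : q ≠ 0 := by positivity
  have hd : q ^ 2 - 1 ≠ 0 := by nlinarith
  have hd' : q - q⁻¹ ≠ 0 := by
    intro h; apply hd; field_simp at h; linarith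
  have e2 : qn q 2 = q + q⁻¹ := by
    unfold qn
    rw [div_eq_iff hd', _root_.zpow_neg]; norm_cast; field_simp; ring
  have e3 : qn q 3 = q ^ 2 + 1 + (q⁻¹) ^ 2 := by
    unfold qn
    rw [div_eq_iff hd', _root_.zpow_neg]; norm_cast; field_simp; ring
  have ew : q ^ (2 : ℤ) + q ^ (-2 : ℤ) = q ^ 2 + (q⁻¹) ^ 2 := by
    rw [_root_.zpow_neg]; norm_cast; rw [inv_pow]
  have ht : √(qn q 3) ^ 2 = qn q 3 := Real.sq_sqrt (by rw [e3]; positivity)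
  have hw : √(q ^ (2 : ℤ) + q ^ (-2 : ℤ)) ^ 2 = q ^ 2 + (q⁻¹) ^ 2 := by
    rw [ew]; exact Real.sq_sqrt (by positivity)
  have t0 : √(qn q 3) ≠ 0 := by
    rw [e3]; positivity
  have b0 : qn q 2 ≠ 0 := by rw [e2]; positivity
  unfold D3 U3 V3
  generalize √(q ^ (2 : ℤ) + q ^ (-2 : ℤ)) = w at *
  generalize √(qn q 3) = t at *
  rw [← ht] at e3 ⊢
  generalize qn q 2 = b at *
  have hi : q * q⁻¹ = 1 := mul_inv_cancel₀ q0
  have hp : -q⁻¹ = q - b := by rw [e2]; ring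
  have htb : t ^ 2 = b ^ 2 - 1 := by rw [e3, e2]; linear_combination -2 * hi
  have hwt : w ^ 2 = t ^ 2 - 1 := by rw [e3, hw]; ring
  rw [R2_aux q b t _ b0 hp htb, M_aux b t w b0 t0 htb, R3_aux q b t w _ t0 hp hwt]
  have hqb : q * b = q ^ 2 + 1 := by rw [e2]; linear_combination hi
  rw [hp]
  clear e2 e3 ew ht hw hp hi hd hd'
  apply charpoly_three
  · simp [Matrix.mul_apply, Fin.sum_univ_three]
    field_simp
    grind
  · simp [Matrix.mul_apply, Fin.sum_univ_three]
    field_simp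
    grind
  · simp only [Matrix.det_mul]
    simp [Matrix.det_fin_three]
    field_simp
    grind
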